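/- Let L be a positive integer and let Γ be a finite subgroup of the orthogonal group O(L) acting linearly on Euclidean space ℝ^L. Then there exists a constant δ₀ ∈ (0,1), depending only on Γ, such that for every r̄ > 0 there exist countably many points p_i ∈ ℝ^L and radii r_i ∈ [δ₀·r̄, r̄] (i ∈ ℕ) with the following properties: the open balls B(p_i, r_i) cover ℝ^L, and for every i and every γ ∈ Γ with γ·p_i ≠ p_i one has ‖γ·p_i − p_i‖ ≥ 200·r_i, so that B(p_i, 100·r_i) is disjoint from γ(B(p_i, 100·r_i)). -/

import Mathlib

open Metric Set

/-- For each point there is a good chart of controlled radius containing it. -/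
lemma exists_good_chart {E : Type*} [NormedAddCommGroup E] [NormedSpace ℝ E]
    (Γ : Subgroup (E ≃ₗᵢ[ℝ] E)) (F : Finset (E ≃ₗᵢ[ℝ] E)) (hF : ∀ g, g ∈ F ↔ g ∈ Γ)
    (s : ℝ) (hs : 0 < s) (x : E) :
    ∃ j ≤ F.card, ∃ p : E, dist x p < s * 402 ^ j ∧
      ∀ γ ∈ Γ, γ p ≠ p → 200 * (s * 402 ^ j) ≤ ‖γ p - p‖ := by
  classical
  set S : ℕ → Finset (E ≃ₗᵢ[ℝ] E) := fun j => F.filter (fun g => ‖g x - x‖ < s * 402 ^ j / 2)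
    with hS
  have hpos : ∀ j : ℕ, 0 < s * 402 ^ j := fun j => by positivity
  have hsucc : ∀ j : ℕ, s * 402 ^ (j + 1) = 402 * (s * 402 ^ j) := fun j => by ring
  have hmono : ∀ j, S j ⊆ S (j + 1) := by
    intro j g hg
    simp only [hS, Finset.mem_filter] at hg ⊢
    refine ⟨hg.1, hg.2.trans ?_⟩
    rw [hsucc]
    linarith [hpos j]
  obtain ⟨j, hj, hjS⟩ : ∃ j ≤ F.card, S j = S (j + 1) := by
    by_contra! hcon
    have key : ∀ j, j ≤ F.card + 1 → j ≤ (S j).card := by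
      intro j
      induction j with
      | zero => intro _; exact Nat.zero_le _
      | succ k ih =>
        intro hk
        have h1 := ih (by omega)
        have h2 := Finset.card_lt_card ((hmono k).ssubset_of_ne (hcon k (by omega)))
        omega
    have h1 := key (F.card + 1) le_rfl
    have h2 : (S (F.card + 1)).card ≤ F.card := Finset.card_filter_le _ _
    omega
  set r := s * 402 ^ j with hr
  have hrpos : 0 < r := hpos j
  have hmem : ∀ g, g ∈ S j ↔ g ∈ Γ ∧ ‖g x - x‖ < r / 2 := by
    intro g; simp only [hS, Finset.mem_filter, hF, hr]
  have hmem' : ∀ g, g ∈ S j ↔ g ∈ Γ ∧ ‖g x - x‖ < 402 * r / 2 := by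
    intro g; rw [hjS]; simp only [hS, Finset.mem_filter, hF, hr, hsucc]
  have hone : (1 : E ≃ₗᵢ[ℝ] E) ∈ S j := by
    rw [hmem]
    refine ⟨Γ.one_mem, ?_⟩
    simp [hrpos]
  have hmul : ∀ g ∈ S j, ∀ h ∈ S j, g * h ∈ S j := by
    intro g hg h hh
    rw [hmem] at hg hh
    rw [hmem']
    refine ⟨Γ.mul_mem hg.1 hh.1, ?_⟩
    have e : (g * h) x - x = g (h x - x) + (g x - x) := by
      rw [map_sub]; simp
    have h1 := norm_add_le (g (h x - x)) (g x - x)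
    rw [g.norm_map] at h1
    rw [e]
    linarith [hg.2, hh.2]
  have hcard : (0 : ℝ) < (S j).card := by
    exact_mod_cast Finset.card_pos.mpr ⟨1, hone⟩
  set p : E := ((S j).card : ℝ)⁻¹ • ∑ g ∈ S j, g x with hp
  have hpx : ‖p - x‖ ≤ r / 2 := by
    have e : p - x = ((S j).card : ℝ)⁻¹ • ∑ g ∈ S j, (g x - x) := by
      rw [Finset.sum_sub_distrib, smul_sub, Finset.sum_const, ← Nat.cast_smul_eq_nsmul ℝ,
        inv_smul_smul₀ hcard.ne']
    have h1 : ‖∑ g ∈ S j, (g x - x)‖ ≤ (S j).card * (r / 2) := by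
      refine (norm_sum_le_of_le (S j) (fun g hg => ((hmem g).1 hg).2.le)).trans ?_
      simp
    rw [e, norm_smul, norm_inv, Real.norm_of_nonneg hcard.le, inv_mul_le_iff₀ hcard]
    exact h1
  refine ⟨j, hj, p, ?_, ?_⟩
  · rw [dist_comm, dist_eq_norm]
    linarith
  · intro γ hγ hne
    by_cases hγS : γ ∈ S j
    · refine absurd ?_ hne
      have himg : (S j).image (fun g => γ * g) = S j := by
        apply Finset.eq_of_subset_of_card_le
        · intro g hg
          obtain ⟨h, hh, rfl⟩ := Finset.mem_image.1 hg
          exact hmul γ hγS h hh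
        · rw [Finset.card_image_of_injective _ (mul_right_injective γ)]
      rw [hp, map_smul, map_sum]
      congr 1
      conv_rhs => rw [← himg]
      rw [Finset.sum_image (fun a _ b _ h => mul_right_injective γ h)]
      rfl
    · have h0 : 402 * r / 2 ≤ ‖γ x - x‖ := by
        by_contra! h
        exact hγS ((hmem' γ).2 ⟨hγ, h⟩)
      have e : γ x - x = (γ p - p) + ((p - x) - γ (p - x)) := by
        rw [map_sub]; abel
      have h1 := norm_add_le (γ p - p) ((p - x) - γ (p - x))
      have h2 := norm_sub_le (p - x) (γ (p - x))
      rw [γ.norm_map] at h2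
      rw [← e] at h1
      linarith

/-- For a finite subgroup `Γ` of the orthogonal group `O(L)` (realized as the
group of linear isometric self-equivalences of Euclidean space `ℝ^L`), there is a constant
`δ₀ ∈ (0,1)` depending only on `Γ` such that for every `rbar > 0` there are countably many balls
`B(pᵢ, rᵢ)` with `rᵢ ∈ [δ₀ rbar, rbar]` covering `ℝ^L`, each of whose centers is moved by at least
`200 rᵢ` by every element of `Γ` not fixing it, so that `B(pᵢ, 100 rᵢ)` is disjoint from its
image under every such element. -/
theorem exists_uniform_orbifold_chart_cover
    (L : ℕ) (hL : 0 < L)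
    (Γ : Subgroup (EuclideanSpace ℝ (Fin L) ≃ₗᵢ[ℝ] EuclideanSpace ℝ (Fin L)))
    (hΓ : (Γ : Set (EuclideanSpace ℝ (Fin L) ≃ₗᵢ[ℝ] EuclideanSpace ℝ (Fin L))).Finite) :
    ∃ δ₀ : ℝ, δ₀ ∈ Set.Ioo (0 : ℝ) 1 ∧
      ∀ rbar : ℝ, 0 < rbar →
        ∃ (p : ℕ → EuclideanSpace ℝ (Fin L)) (r : ℕ → ℝ),
          (∀ i, r i ∈ Set.Icc (δ₀ * rbar) rbar) ∧
          (⋃ i, Metric.ball (p i) (r i)) = Set.univ ∧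
          ∀ i, ∀ γ ∈ Γ, γ (p i) ≠ p i →
            200 * r i ≤ ‖γ (p i) - p i‖ ∧
            Disjoint (Metric.ball (p i) (100 * r i))
              (⇑γ '' Metric.ball (p i) (100 * r i)) := by
  classical
  set F := hΓ.toFinset with hFdef
  have hF : ∀ g, g ∈ F ↔ g ∈ Γ := fun g => by simp [hFdef]
  set n := F.card
  have hpw : (1 : ℝ) < 402 ^ (n + 1) := one_lt_pow₀ (by norm_num) (by omega)
  refine ⟨(402 ^ (n + 1))⁻¹, ⟨by positivity, inv_lt_one_of_one_lt₀ hpw⟩, ?_⟩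
  intro rbar hrbar
  set s := ((402 : ℝ) ^ (n + 1))⁻¹ * rbar with hs
  have hspos : 0 < s := by positivity
  choose j hj P hP hPγ using exists_good_chart Γ F hF s hspos
  obtain ⟨T, hT, hcov⟩ := TopologicalSpace.countable_cover_nhds
    (f := fun x => ball (P x) (s * 402 ^ j x))
    (fun x => isOpen_ball.mem_nhds (mem_ball.2 (hP x)))
  have hTne : T.Nonempty := by
    have h0 : (0 : EuclideanSpace ℝ (Fin L)) ∈ ⋃ x ∈ T, ball (P x) (s * 402 ^ j x) := by
      rw [hcov]; trivial
    obtain ⟨x, hx, _⟩ := mem_iUnion₂.1 h0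
    exact ⟨x, hx⟩
  obtain ⟨f, rfl⟩ := hT.exists_eq_range hTne
  refine ⟨fun i => P (f i), fun i => s * 402 ^ j (f i), ?_, ?_, ?_⟩
  · intro i
    refine ⟨le_mul_of_one_le_right hspos.le (one_le_pow₀ (by norm_num)), ?_⟩
    have h1 : (402 : ℝ) ^ j (f i) ≤ 402 ^ (n + 1) :=
      pow_le_pow_right₀ (by norm_num) ((hj (f i)).trans (Nat.le_succ n))
    calc s * 402 ^ j (f i) ≤ s * 402 ^ (n + 1) := by gcongr
      _ = rbar := by rw [hs]; field_simp
  · rw [← hcov, biUnion_range]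
  · intro i γ hγ hne
    have h200 := hPγ (f i) γ hγ hne
    refine ⟨h200, ?_⟩
    rw [Set.disjoint_left]
    rintro y hy ⟨z, hz, rfl⟩
    rw [mem_ball] at hy hz
    rw [← γ.dist_map] at hz
    have h1 := dist_triangle_left (γ (P (f i))) (P (f i)) (γ z)
    rw [dist_eq_norm] at h1
    linarith
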